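/- For an odd integer k > 1, the three coprime pairs (1,0), (1,k), (2,k) satisfy pairwise determinant condition |p·q' - q·p'| = k, i.e., they form a triangle in the k-Farey graph F_k; moreover no four coprime pairs, pairwise distinct up to sign, can have all pairwise determinants of absolute value equal to k. Hence the clique number of F_k is 3 for odd k > 1. -/

import Mathlib

theorem stmt_3 (k : ℤ) (hk : 1 < k) (hko : Odd k) :
    (|1 * k - 0 * 1| = k ∧ |1 * k - 0 * 2| = k ∧ |1 * k - k * 2| = k) ∧
    ¬ ∃ p₁ q₁ p₂ q₂ p₃ q₃ p₄ q₄ : ℤ,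
      IsCoprime p₁ q₁ ∧ IsCoprime p₂ q₂ ∧ IsCoprime p₃ q₃ ∧ IsCoprime p₄ q₄ ∧
      ((p₁, q₁) ≠ (p₂, q₂) ∧ (p₁, q₁) ≠ (-p₂, -q₂)) ∧
      ((p₁, q₁) ≠ (p₃, q₃) ∧ (p₁, q₁) ≠ (-p₃, -q₃)) ∧
      ((p₁, q₁) ≠ (p₄, q₄) ∧ (p₁, q₁) ≠ (-p₄, -q₄)) ∧
      ((p₂, q₂) ≠ (p₃, q₃) ∧ (p₂, q₂) ≠ (-p₃, -q₃)) ∧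
      ((p₂, q₂) ≠ (p₄, q₄) ∧ (p₂, q₂) ≠ (-p₄, -q₄)) ∧
      ((p₃, q₃) ≠ (p₄, q₄) ∧ (p₃, q₃) ≠ (-p₄, -q₄)) ∧
      |p₁ * q₂ - q₁ * p₂| = k ∧ |p₁ * q₃ - q₁ * p₃| = k ∧
      |p₁ * q₄ - q₁ * p₄| = k ∧ |p₂ * q₃ - q₂ * p₃| = k ∧
      |p₂ * q₄ - q₂ * p₄| = k ∧ |p₃ * q₄ - q₃ * p₄| = k := by
  refine ⟨⟨?_, ?_, ?_⟩, ?_⟩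
  · rw [abs_of_pos] <;> linarith
  · rw [abs_of_pos] <;> linarith
  · rw [abs_of_neg] <;> linarith
  · rintro ⟨p₁, q₁, p₂, q₂, p₃, q₃, p₄, q₄, -, -, -, -, -, -, -, -, -, -,
      h₁₂, h₁₃, h₁₄, h₂₃, h₂₄, h₃₄⟩
    have odd_of_abs {x : ℤ} (hx : |x| = k) : Odd x := odd_abs.mp (hx ▸ hko)
    -- The three products in the Plücker relation are odd, so they cannot sum to zero.
    have hsum := (((odd_of_abs h₁₂).mul (odd_of_abs h₃₄)).sub_odd
      ((odd_of_abs h₁₃).mul (odd_of_abs h₂₄))).add_odd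
      ((odd_of_abs h₁₄).mul (odd_of_abs h₂₃))
    have hzero : (p₁ * q₂ - q₁ * p₂) * (p₃ * q₄ - q₃ * p₄)
        - (p₁ * q₃ - q₁ * p₃) * (p₂ * q₄ - q₂ * p₄)
        + (p₁ * q₄ - q₁ * p₄) * (p₂ * q₃ - q₂ * p₃) = 0 := by ring
    rw [hzero] at hsum
    simp at hsum
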